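/- Let p,q∈(1,∞). (a) If 1<p≤2≤q<∞, then (σ,w)_{p,q}=[σ,w]_{p,q} for all Radon measures σ and w on ℝ^N. (b) If 2<p<∞ or 1<q<2, then there exist Radon measures σ and w on ℝ^N such that (σ,w)_{p,q}<∞ but [σ,w]_{p,q}=∞. -/

import Mathlib

open MeasureTheory ENNReal Set

noncomputable section

abbrev EucN (N : ℕ) := Fin N → ℝ

/-- The half-open cube `x + [0, 2^{-k})^N`. -/
def dyCube (N : ℕ) (k : ℤ) (x : EucN N) : Set (EucN N) :=
  {y | ∀ i, x i ≤ y i ∧ y i < x i + (2 : ℝ) ^ (-k)}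

/-- A dyadic lattice on `ℝ^N`: for every `k ∈ ℤ`, `gen k` is a partition of `ℝ^N` into
half-open cubes of side `2^{-k}`, and the generations are nested. -/
structure DyadicLattice (N : ℕ) where
  gen : ℤ → Set (Set (EucN N))
  cube_form : ∀ k Q, Q ∈ gen k → ∃ x, Q = dyCube N k x
  covers : ∀ k (y : EucN N), ∃ Q ∈ gen k, y ∈ Q
  pairwiseDisjoint : ∀ k, (gen k).PairwiseDisjoint id
  nested : ∀ k, ∀ Q ∈ gen (k + 1), ∃ R ∈ gen k, Q ⊆ R

namespace DyadicLattice
variable {N : ℕ}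
/-- The collection `𝒟` of all dyadic cubes. -/
def cubes (D : DyadicLattice N) : Set (Set (EucN N)) := ⋃ k, D.gen k
/-- `Q'` is a dyadic child of `Q`. -/
def child (D : DyadicLattice N) (Q Q' : Set (EucN N)) : Prop :=
  ∃ k, Q ∈ D.gen k ∧ Q' ∈ D.gen (k + 1) ∧ Q' ⊆ Q
/-- `R = Q^{(r)}` is the `r`-th dyadic ancestor of `Q`. -/
def anc (D : DyadicLattice N) (r : ℕ) (Q R : Set (EucN N)) : Prop :=
  ∃ k : ℤ, Q ∈ D.gen k ∧ R ∈ D.gen (k - r) ∧ Q ⊆ R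
end DyadicLattice

/-- `ℝ≥0∞`-valued indicator of a set. -/
def indE {N : ℕ} (Q : Set (EucN N)) (x : EucN N) : ℝ≥0∞ := Q.indicator 1 x

/-- `‖ (∑ i (f i)²)^{1/2} ‖_{L^p(μ)}` for a family of `ℝ≥0∞`-valued functions. -/
def sqNorm {N : ℕ} {ι : Type*} (μ : Measure (EucN N)) (p : ℝ)
    (f : ι → EucN N → ℝ≥0∞) : ℝ≥0∞ :=
  (∫⁻ x, (∑' i, f i x ^ 2) ^ (p / 2) ∂μ) ^ (1 / p)

/-- The quadratic `𝒜_{p,q}` constant `[σ,w]_{p,q}`: the least `C` such that for all real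
coefficients `(a_Q)_{Q ∈ 𝒟}`,
`‖(∑_Q (a_Q σ(Q)/|Q|)² 1_Q)^{1/2}‖_{L^q(w)} ≤ C ‖(∑_Q a_Q² 1_Q)^{1/2}‖_{L^p(σ)}`. -/
def sqA {N : ℕ} (D : DyadicLattice N) (σ w : Measure (EucN N)) (p q : ℝ) : ℝ≥0∞ :=
  sInf {C | ∀ a : Set (EucN N) → ℝ,
    sqNorm w q (fun Q : D.cubes => fun x =>
      (‖a (Q : Set (EucN N))‖₊ : ℝ≥0∞) * σ (Q : Set (EucN N)) / volume (Q : Set (EucN N))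
        * indE (Q : Set (EucN N)) x)
    ≤ C * sqNorm σ p (fun Q : D.cubes => fun x =>
      (‖a (Q : Set (EucN N))‖₊ : ℝ≥0∞) * indE (Q : Set (EucN N)) x)}

/-- The simple (Muckenhoupt type) `A_{p,q}` constant
`(σ,w)_{p,q} = sup_{Q ∈ 𝒟} σ(Q)^{1/p'} w(Q)^{1/q} / |Q|`. -/
def simpleA {N : ℕ} (D : DyadicLattice N) (σ w : Measure (EucN N)) (p q : ℝ) : ℝ≥0∞ :=
  ⨆ Q ∈ D.cubes, σ Q ^ (1 - 1 / p) * w Q ^ (1 / q) / volume Q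

/-- Minkowski's inequality for countable sums of nonnegative functions. -/
theorem lintegral_tsum_rpow_le {α ι : Type*} [MeasurableSpace α] [Countable ι] {μ : Measure α}
    {g : ι → α → ℝ≥0∞} (hg : ∀ i, Measurable (g i)) {s : ℝ} (hs : 1 ≤ s) :
    (∫⁻ x, (∑' i, g i x) ^ s ∂μ) ^ (1 / s) ≤ ∑' i, (∫⁻ x, g i x ^ s ∂μ) ^ (1 / s) := by
  have hs0 : 0 < s := by linarith
  have hfin : ∀ F : Finset ι, (∫⁻ x, (∑ i ∈ F, g i x) ^ s ∂μ) ^ (1 / s)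
      ≤ ∑ i ∈ F, (∫⁻ x, g i x ^ s ∂μ) ^ (1 / s) := by
    classical
    intro F
    induction F using Finset.induction_on with
    | empty => simp [hs0]
    | insert i F hi ih =>
      simp only [Finset.sum_insert hi]
      refine (lintegral_Lp_add_le (hg i).aemeasurable
        (Finset.measurable_fun_sum F fun i _ => hg i).aemeasurable hs).trans ?_
      gcongr
  rw [one_div, ENNReal.rpow_inv_le_iff hs0]
  have hsup : ∀ x, (∑' i, g i x) ^ s = ⨆ F : Finset ι, (∑ i ∈ F, g i x) ^ s := fun x => by
    rw [ENNReal.tsum_eq_iSup_sum]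
    exact (ENNReal.orderIsoRpow s hs0).map_iSup _
  simp only [hsup]
  rw [lintegral_iSup_directed_of_measurable]
  · refine iSup_le fun F => ?_
    rw [← ENNReal.rpow_inv_le_iff hs0, ← one_div]
    exact (hfin F).trans (ENNReal.sum_le_tsum F)
  · exact fun F => (Finset.measurable_fun_sum F fun i _ => hg i).pow_const s
  · intro F G
    classical
    refine ⟨F ∪ G, fun x => ?_, fun x => ?_⟩ <;> dsimp only <;> gcongr <;> simp

/-- The reverse Minkowski inequality for exponents at most one. -/
theorem tsum_lintegral_rpow_le {α ι : Type*} [MeasurableSpace α] [Countable ι] {μ : Measure α}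
    {g : ι → α → ℝ≥0∞} (hg : ∀ i, Measurable (g i)) {s : ℝ} (hs0 : 0 < s) (hs : s ≤ 1) :
    ∑' i, (∫⁻ x, g i x ^ s ∂μ) ^ (1 / s) ≤ (∫⁻ x, (∑' i, g i x) ^ s ∂μ) ^ (1 / s) := by
  set G : α → ℝ≥0∞ := fun x => ∑' i, g i x
  have hGm : Measurable G := Measurable.tsum hg
  by_cases htop : ∫⁻ x, G x ^ s ∂μ = ∞
  · change _ ≤ (∫⁻ x, G x ^ s ∂μ) ^ (1 / s)
    simp [htop, hs0]
  have hgG : ∀ i, Measurable fun x => g i x * G x ^ (s - 1) :=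
    fun i => (hg i).mul (hGm.pow_const _)
  have hfin : ∀ᵐ x ∂μ, G x ≠ ∞ := by
    filter_upwards [ae_lt_top (hGm.pow_const s) htop] with x hx h
    simp [h, hs0] at hx
  have hle : ∀ i, (∫⁻ x, g i x ^ s ∂μ) ^ (1 / s)
      ≤ (∫⁻ x, g i x * G x ^ (s - 1) ∂μ) * (∫⁻ x, G x ^ s ∂μ) ^ ((1 - s) / s) := by
    intro i
    have h1 : ∫⁻ x, g i x ^ s ∂μ
        = ∫⁻ x, (g i x * G x ^ (s - 1)) ^ s * (G x ^ s) ^ (1 - s) ∂μ := by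
      refine lintegral_congr_ae ?_
      filter_upwards [hfin] with x hx
      have hle : g i x ≤ G x := ENNReal.le_tsum i
      rcases eq_or_ne (G x) 0 with h0 | h0
      · have : g i x = 0 := by simpa [h0] using hle
        simp [this, hs0]
      · rw [ENNReal.mul_rpow_of_nonneg _ _ hs0.le, mul_assoc, ← ENNReal.rpow_mul,
          ← ENNReal.rpow_mul, ← ENNReal.rpow_add _ _ h0 hx]
        have : (s - 1) * s + s * (1 - s) = 0 := by ring
        simp [this]
    rw [h1]
    refine (ENNReal.rpow_le_rpow (ENNReal.lintegral_mul_norm_pow_le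
      (hgG i).aemeasurable (hGm.pow_const s).aemeasurable hs0.le
      (by linarith) (by ring)) (by positivity)).trans_eq ?_
    rw [ENNReal.mul_rpow_of_nonneg _ _ (by positivity), ← ENNReal.rpow_mul, ← ENNReal.rpow_mul,
      mul_one_div_cancel hs0.ne', ENNReal.rpow_one, mul_one_div]
  refine (ENNReal.tsum_le_tsum hle).trans_eq ?_
  rw [ENNReal.tsum_mul_right, ← lintegral_tsum fun i => (hgG i).aemeasurable]
  have h2 : ∫⁻ x, ∑' i, g i x * G x ^ (s - 1) ∂μ = ∫⁻ x, G x ^ s ∂μ := by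
    refine lintegral_congr_ae ?_
    filter_upwards [hfin] with x hx
    rw [ENNReal.tsum_mul_right]
    change G x * _ = _
    rcases eq_or_ne (G x) 0 with h0 | h0
    · simp [h0, hs0]
    · nth_rewrite 1 [← ENNReal.rpow_one (G x)]
      rw [← ENNReal.rpow_add _ _ h0 hx]
      congr 1; ring
  rw [h2]
  change _ = (∫⁻ x, G x ^ s ∂μ) ^ (1 / s)
  nth_rewrite 1 [← ENNReal.rpow_one (∫⁻ x, G x ^ s ∂μ)]
  rw [← ENNReal.rpow_add_of_nonneg _ _ zero_le_one (div_nonneg (by linarith) hs0.le)]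
  congr 1; field_simp; ring

theorem lintegral_sq_mul_indE_rpow {N : ℕ} {μ : Measure (EucN N)} {Q : Set (EucN N)}
    (hQ : MeasurableSet Q) (b : ℝ≥0∞) {p : ℝ} (hp : 0 < p) :
    (∫⁻ x, ((b * indE Q x) ^ 2) ^ (p / 2) ∂μ) ^ (1 / (p / 2)) = (b * μ Q ^ (1 / p)) ^ 2 := by
  have h : ∀ x, ((b * indE Q x) ^ 2) ^ (p / 2) = Q.indicator (fun _ => b ^ p) x := fun x => by
    by_cases hx : x ∈ Q
    · simp only [indE, hx, indicator_of_mem, Pi.one_apply, mul_one]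
      rw [← ENNReal.rpow_natCast, ← ENNReal.rpow_mul]
      congr 1; push_cast; ring
    · simp [indE, hx, hp]
  simp only [h]
  rw [lintegral_indicator_const hQ, ENNReal.mul_rpow_of_nonneg _ _ (by positivity),
    ← ENNReal.rpow_mul, ← ENNReal.rpow_natCast, ENNReal.mul_rpow_of_nonneg _ _ (by positivity),
    ← ENNReal.rpow_mul]
  congr 2
  · field_simp; norm_num
  · push_cast; field_simp

theorem measurable_sq_mul_indE {N : ℕ} {Q : Set (EucN N)} (hQ : MeasurableSet Q) (b : ℝ≥0∞) :
    Measurable fun x => (b * indE Q x) ^ 2 :=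
  ((measurable_one.indicator hQ).const_mul b).pow_const 2

theorem sqNorm_eq_rpow_half {N : ℕ} {ι : Type*} (μ : Measure (EucN N)) (p : ℝ)
    (f : ι → EucN N → ℝ≥0∞) :
    sqNorm μ p f = ((∫⁻ x, (∑' i, f i x ^ 2) ^ (p / 2) ∂μ) ^ (1 / (p / 2))) ^ (1 / 2 : ℝ) := by
  rw [sqNorm, ← ENNReal.rpow_mul]
  congr 1; ring

theorem sqNorm_mul_indE_le {N : ℕ} {ι : Type*} [Countable ι] {μ : Measure (EucN N)}
    {Q : ι → Set (EucN N)} (hQ : ∀ i, MeasurableSet (Q i)) (b : ι → ℝ≥0∞) {q : ℝ} (hq : 2 ≤ q) :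
    sqNorm μ q (fun i x => b i * indE (Q i) x)
      ≤ (∑' i, (b i * μ (Q i) ^ (1 / q)) ^ 2) ^ (1 / 2 : ℝ) := by
  rw [sqNorm_eq_rpow_half]
  refine ENNReal.rpow_le_rpow ((lintegral_tsum_rpow_le
    (fun i => measurable_sq_mul_indE (hQ i) (b i)) (by linarith)).trans_eq ?_) (by norm_num)
  exact tsum_congr fun i => lintegral_sq_mul_indE_rpow (hQ i) _ (by linarith)

theorem le_sqNorm_mul_indE {N : ℕ} {ι : Type*} [Countable ι] {μ : Measure (EucN N)}
    {Q : ι → Set (EucN N)} (hQ : ∀ i, MeasurableSet (Q i)) (b : ι → ℝ≥0∞) {p : ℝ} (hp0 : 0 < p)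
    (hp : p ≤ 2) :
    (∑' i, (b i * μ (Q i) ^ (1 / p)) ^ 2) ^ (1 / 2 : ℝ)
      ≤ sqNorm μ p (fun i x => b i * indE (Q i) x) := by
  rw [sqNorm_eq_rpow_half]
  refine ENNReal.rpow_le_rpow (le_trans (le_of_eq ?_) (tsum_lintegral_rpow_le
    (fun i => measurable_sq_mul_indE (hQ i) (b i)) (by linarith) (by linarith))) (by norm_num)
  exact tsum_congr fun i => (lintegral_sq_mul_indE_rpow (hQ i) _ hp0).symm

theorem dyCube_eq_pi (N : ℕ) (k : ℤ) (x : EucN N) :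
    dyCube N k x = univ.pi fun i => Ico (x i) (x i + (2 : ℝ) ^ (-k)) := by
  ext y; simp [dyCube, mem_pi]

theorem volume_dyCube (N : ℕ) (k : ℤ) (x : EucN N) :
    volume (dyCube N k x) = ENNReal.ofReal ((2 : ℝ) ^ (-k)) ^ N := by
  rw [dyCube_eq_pi, Real.volume_pi_Ico]
  simp

namespace DyadicLattice
variable {N : ℕ} (D : DyadicLattice N)

theorem exists_dyCube_of_mem_cubes {Q : Set (EucN N)} (hQ : Q ∈ D.cubes) :
    ∃ k x, Q = dyCube N k x := by
  obtain ⟨k, hk⟩ := mem_iUnion.1 hQ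
  obtain ⟨x, hx⟩ := D.cube_form k Q hk
  exact ⟨k, x, hx⟩

theorem measurableSet_of_mem_cubes {Q : Set (EucN N)} (hQ : Q ∈ D.cubes) : MeasurableSet Q := by
  obtain ⟨k, x, rfl⟩ := D.exists_dyCube_of_mem_cubes hQ
  rw [dyCube_eq_pi]
  exact MeasurableSet.univ_pi fun i => measurableSet_Ico

theorem volume_ne_zero_of_mem_cubes {Q : Set (EucN N)} (hQ : Q ∈ D.cubes) : volume Q ≠ 0 := by
  obtain ⟨k, x, rfl⟩ := D.exists_dyCube_of_mem_cubes hQ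
  rw [volume_dyCube]
  refine pow_ne_zero _ ?_
  simpa using by positivity

theorem measure_ne_top_of_mem_cubes {μ : Measure (EucN N)} [IsLocallyFiniteMeasure μ]
    {Q : Set (EucN N)} (hQ : Q ∈ D.cubes) : μ Q ≠ ∞ := by
  obtain ⟨k, x, rfl⟩ := D.exists_dyCube_of_mem_cubes hQ
  refine ne_top_of_le_ne_top (isCompact_Icc.measure_lt_top (μ := μ)
    (K := Icc x (fun i => x i + (2 : ℝ) ^ (-k)))).ne (measure_mono fun y hy => ?_)
  exact ⟨fun i => (hy i).1, fun i => (hy i).2.le⟩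

theorem countable_cubes : D.cubes.Countable := by
  refine countable_iUnion fun k => ?_
  refine (D.pairwiseDisjoint k).countable_of_nonempty_interior fun Q hQ => ?_
  obtain ⟨x, rfl⟩ := D.cube_form k Q hQ
  have h2 : (0 : ℝ) < 2 ^ (-k) := by positivity
  refine ⟨fun i => x i + 2 ^ (-k) / 2, mem_interior.2
    ⟨univ.pi fun i => Ioo (x i) (x i + (2 : ℝ) ^ (-k)), ?_,
      isOpen_set_pi finite_univ fun i _ => isOpen_Ioo, fun i _ => ⟨?_, ?_⟩⟩⟩
  · rw [dyCube_eq_pi]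
    exact pi_mono fun i _ => Ioo_subset_Ico_self
  · simp only; linarith
  · simp only; linarith

end DyadicLattice

theorem simpleA_le_sqA {N : ℕ} (D : DyadicLattice N) (σ w : Measure (EucN N))
    [IsLocallyFiniteMeasure σ] [IsLocallyFiniteMeasure w] {p q : ℝ} (hp : 1 < p) (hq : 1 < q) :
    simpleA D σ w p q ≤ sqA D σ w p q := by
  classical
  refine le_sInf fun C hC => iSup₂_le fun Q hQ => ?_
  have hp' : 0 < 1 - 1 / p := by rw [sub_pos, div_lt_one] <;> linarith
  rcases eq_or_ne (σ Q) 0 with h0 | h0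
  · rw [h0, ENNReal.zero_rpow_of_pos hp']
    simp
  have hσ := D.measure_ne_top_of_mem_cubes (μ := σ) hQ
  have hsingle : ∀ (μ : Measure (EucN N)) (r : ℝ) (b : Set (EucN N) → ℝ≥0∞), 0 < r →
      (∀ R ≠ Q, b R = 0) →
      sqNorm μ r (fun R : D.cubes => fun x => b R * indE (R : Set (EucN N)) x)
        = b Q * μ Q ^ (1 / r) := by
    intro μ r b hr hb
    rw [sqNorm_eq_rpow_half]
    have : ∀ x, ∑' R : D.cubes, (b R * indE (R : Set (EucN N)) x) ^ 2 = (b Q * indE Q x) ^ 2 :=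
      fun x => tsum_eq_single (⟨Q, hQ⟩ : D.cubes) fun R hR => by
        rw [hb R fun h => hR (Subtype.ext h)]; simp
    simp only [this]
    rw [lintegral_sq_mul_indE_rpow (D.measurableSet_of_mem_cubes hQ) _ hr,
      ← ENNReal.rpow_natCast, ← ENNReal.rpow_mul]
    norm_num
  have h := hC (fun R => if R = Q then 1 else 0)
  rw [hsingle w q (fun R => (‖(if R = Q then 1 else 0 : ℝ)‖₊ : ℝ≥0∞) * σ R / volume R)
      (by linarith) (fun R hR => by simp [hR]),
    hsingle σ p (fun R => (‖(if R = Q then 1 else 0 : ℝ)‖₊ : ℝ≥0∞))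
      (by linarith) (fun R hR => by simp [hR])] at h
  simp only [if_true, nnnorm_one, ENNReal.coe_one, one_mul] at h
  have hpos : σ Q ^ (1 / p) ≠ 0 := by simp [h0, hσ]
  have hfin : σ Q ^ (1 / p) ≠ ∞ := ENNReal.rpow_ne_top_of_nonneg (by positivity) hσ
  rw [← ENNReal.mul_le_mul_iff_left hpos hfin]
  refine le_trans (le_of_eq ?_) h
  have hsplit : σ Q = σ Q ^ (1 - 1 / p) * σ Q ^ (1 / p) := by
    rw [← ENNReal.rpow_add _ _ h0 hσ]; simp
  nth_rewrite 3 [hsplit]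
  simp only [div_eq_mul_inv]
  ring

theorem sqA_le_simpleA {N : ℕ} (D : DyadicLattice N) (σ w : Measure (EucN N))
    {p q : ℝ} (hp : 1 < p) (hp2 : p ≤ 2) (hq : 2 ≤ q) :
    sqA D σ w p q ≤ simpleA D σ w p q := by
  have := D.countable_cubes.to_subtype
  have hm : ∀ Q : D.cubes, MeasurableSet (Q : Set (EucN N)) :=
    fun Q => D.measurableSet_of_mem_cubes Q.2
  refine sInf_le fun a => ?_
  refine (sqNorm_mul_indE_le hm _ hq).trans ?_
  refine le_trans ?_ (mul_le_mul_right (le_sqNorm_mul_indE hm _ (by linarith) hp2) _)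
  have hsq : ∀ A : ℝ≥0∞, A = (A ^ 2) ^ (1 / 2 : ℝ) := fun A => by
    rw [← ENNReal.rpow_natCast, ← ENNReal.rpow_mul]; norm_num
  rw [hsq (simpleA D σ w p q)]
  rw [← ENNReal.mul_rpow_of_nonneg _ _ (by norm_num), ← ENNReal.tsum_mul_left]
  refine ENNReal.rpow_le_rpow (ENNReal.tsum_le_tsum fun Q => ?_) (by norm_num)
  rw [← mul_pow]
  refine pow_le_pow_left' ?_ 2
  have hA : σ (Q : Set (EucN N)) ^ (1 - 1 / p) * w (Q : Set (EucN N)) ^ (1 / q)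
      / volume (Q : Set (EucN N)) ≤ simpleA D σ w p q :=
    le_iSup₂_of_le (Q : Set (EucN N)) Q.2 le_rfl
  have hp' : 0 ≤ 1 - 1 / p := by rw [sub_nonneg, div_le_one] <;> linarith
  have hsplit : σ (Q : Set (EucN N))
      = σ (Q : Set (EucN N)) ^ (1 - 1 / p) * σ (Q : Set (EucN N)) ^ (1 / p) := by
    rw [← ENNReal.rpow_add_of_nonneg _ _ hp' (by positivity)]; simp
  refine le_trans (le_of_eq ?_) (mul_le_mul_left hA _)
  nth_rewrite 1 [hsplit]
  simp only [div_eq_mul_inv]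
  ring

namespace DyadicLattice
variable {N : ℕ} (D : DyadicLattice N)

theorem volume_of_mem_gen {k : ℕ} {Q : Set (EucN N)} (hQ : Q ∈ D.gen k) :
    volume Q = (2⁻¹ ^ N : ℝ≥0∞) ^ k := by
  obtain ⟨x, rfl⟩ := D.cube_form k Q hQ
  rw [volume_dyCube, zpow_neg, zpow_natCast, ← inv_pow, ENNReal.ofReal_pow (by positivity),
    ENNReal.ofReal_inv_of_pos two_pos, ENNReal.ofReal_ofNat, ← pow_mul, ← pow_mul, mul_comm]

/-- A point of each set of the decreasing sequence of cubes containing the origin, outside the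
next one. -/
theorem exists_tower (hN : 1 ≤ N) : ∃ (Q : ℕ → Set (EucN N)) (x : ℕ → EucN N),
    (∀ k : ℕ, Q k ∈ D.gen k) ∧ (∀ k, 0 ∈ Q k) ∧ (∀ j k, x k ∈ Q j ↔ j ≤ k) ∧
    ∀ S ∈ D.cubes, 0 ∈ S → (∃ k, S = Q k) ∨ 1 ≤ volume S := by
  choose Q hQ h0 using fun k : ℕ => D.covers k 0
  have huniq : ∀ (k : ℕ) S, S ∈ D.gen k → 0 ∈ S → S = Q k := fun k S hS hS0 => by
    by_contra hne
    exact disjoint_left.1 (D.pairwiseDisjoint k hS (hQ k) hne) hS0 (h0 k)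
  have hanti : Antitone Q := antitone_nat_of_succ_le fun k => by
    obtain ⟨R, hR, hsub⟩ := D.nested k (Q (k + 1)) (by exact_mod_cast hQ (k + 1))
    rw [← huniq k R hR (hsub (h0 _))]
    exact hsub
  have hx : ∀ k, ∃ x ∈ Q k, x ∉ Q (k + 1) := fun k => by
    refine not_subset.1 fun hsub => ?_
    have h := measure_mono (μ := volume) hsub
    rw [D.volume_of_mem_gen (hQ k), D.volume_of_mem_gen (hQ (k + 1)), ← pow_mul, ← pow_mul,
      ← ENNReal.inv_pow, ← ENNReal.inv_pow, ENNReal.inv_le_inv] at h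
    norm_cast at h
    rw [Nat.pow_le_pow_iff_right (by norm_num)] at h
    nlinarith
  choose x hx hx' using hx
  refine ⟨Q, x, hQ, h0, fun j k => ⟨fun h => ?_, fun h => hanti h (hx k)⟩, fun S hS hS0 => ?_⟩
  · by_contra hlt
    exact hx' k (hanti (by omega) h)
  · obtain ⟨k, hk⟩ := mem_iUnion.1 hS
    rcases le_or_gt 0 k with h | h
    · lift k to ℕ using h
      exact Or.inl ⟨k, huniq k S hk hS0⟩
    · right
      obtain ⟨y, rfl⟩ := D.cube_form k S hk
      rw [volume_dyCube]
      refine one_le_pow₀ ?_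
      rw [ENNReal.one_le_ofReal]
      exact one_le_zpow₀ one_le_two (by omega)

end DyadicLattice

/-- The discrete measure with mass `R ^ k` at the point `x k`. -/
def geomMeasure {N : ℕ} (x : ℕ → EucN N) (R : ℝ≥0∞) : Measure (EucN N) :=
  Measure.sum fun k => R ^ k • Measure.dirac (x k)

section geomMeasure
variable {N : ℕ} {x : ℕ → EucN N} {R : ℝ≥0∞}

theorem lintegral_geomMeasure (f : EucN N → ℝ≥0∞) :
    ∫⁻ y, f y ∂geomMeasure x R = ∑' k, R ^ k * f (x k) := by
  simp [geomMeasure, lintegral_sum_measure, lintegral_smul_measure]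

theorem geomMeasure_univ : geomMeasure x R univ = (1 - R)⁻¹ := by
  rw [← lintegral_one, lintegral_geomMeasure]
  simp [ENNReal.tsum_geometric]

theorem isFiniteMeasure_geomMeasure (hR : R < 1) : IsFiniteMeasure (geomMeasure x R) := by
  refine ⟨?_⟩
  rw [geomMeasure_univ]
  simpa using hR

theorem geomMeasure_tower {Q : ℕ → Set (EucN N)} (hx : ∀ j k, x k ∈ Q j ↔ j ≤ k) {j : ℕ}
    (hQ : MeasurableSet (Q j)) : geomMeasure x R (Q j) = R ^ j * (1 - R)⁻¹ := by
  rw [← lintegral_indicator_one hQ, lintegral_geomMeasure, ← ENNReal.tsum_geometric,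
    ← ENNReal.tsum_mul_left, ← (add_left_injective j).tsum_eq]
  · refine tsum_congr fun k => ?_
    rw [indicator_of_mem ((hx _ _).2 (Nat.le_add_left j k)), pow_add]
    simp [mul_comm]
  · intro k hk
    have hjk : j ≤ k := by
      by_contra h
      exact hk (by simp [indicator_of_notMem (fun h' => h ((hx j k).1 h'))])
    exact ⟨k - j, Nat.sub_add_cancel hjk⟩

theorem sqNorm_geomMeasure {Q : ℕ → Set (EucN N)} (hx : ∀ j k, x k ∈ Q j ↔ j ≤ k)
    (p : ℝ) (b : ℕ → ℝ≥0∞) :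
    sqNorm (geomMeasure x R) p (fun k y => b k * indE (Q k) y)
      = (∑' k, R ^ k * (∑ j ∈ Finset.range (k + 1), b j ^ 2) ^ (p / 2)) ^ (1 / p) := by
  rw [sqNorm, lintegral_geomMeasure]
  congr! 5 with k
  rw [tsum_eq_sum (s := Finset.range (k + 1))]
  · refine Finset.sum_congr rfl fun j hj => ?_
    have : x k ∈ Q j := (hx j k).2 (by simpa [Nat.lt_succ_iff] using hj)
    simp [indE, this]
  · intro j hj
    have : x k ∉ Q j := fun h => hj (by simpa [Nat.lt_succ_iff] using (hx j k).1 h)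
    simp [indE, this]

end geomMeasure

theorem sqNorm_dirac {N : ℕ} {y : EucN N} {Q : ℕ → Set (EucN N)} (hQ : ∀ k, y ∈ Q k)
    (p : ℝ) (b : ℕ → ℝ≥0∞) :
    sqNorm (Measure.dirac y) p (fun k z => b k * indE (Q k) z)
      = ((∑' k, b k ^ 2) ^ (p / 2)) ^ (1 / p) := by
  simp [sqNorm, indE, hQ]

theorem sqNorm_cubes_eq_sqNorm_nat {N : ℕ} (D : DyadicLattice N) (μ : Measure (EucN N)) (p : ℝ)
    {Q : ℕ → Set (EucN N)} (hQ : ∀ k, Q k ∈ D.cubes) (hinj : Function.Injective Q)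
    {b : Set (EucN N) → ℝ≥0∞} (hb : ∀ S ∉ range Q, b S = 0) :
    sqNorm μ p (fun S : D.cubes => fun x => b S * indE (S : Set (EucN N)) x)
      = sqNorm μ p (fun k x => b (Q k) * indE (Q k) x) := by
  have hinj' : Function.Injective fun k => (⟨Q k, hQ k⟩ : D.cubes) :=
    fun i j h => hinj (congrArg Subtype.val h)
  unfold sqNorm
  congr! 4 with x
  refine (hinj'.tsum_eq (f := fun S : D.cubes => (b S * indE (S : Set (EucN N)) x) ^ 2)
    fun S hS => ?_).symm
  by_contra h
  refine hS ?_
  dsimp only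
  rw [hb S fun ⟨k, hk⟩ => h ⟨k, Subtype.ext hk⟩]
  simp

theorem sqA_eq_top {N : ℕ} (D : DyadicLattice N) {σ w : Measure (EucN N)} {p q : ℝ}
    {Q : ℕ → Set (EucN N)} (hQ : ∀ k, Q k ∈ D.cubes) (hinj : Function.Injective Q)
    {b : ℕ → ℝ≥0∞} (hb : ∀ k, b k ≠ ∞)
    (hw : sqNorm w q (fun k x => b k * σ (Q k) / volume (Q k) * indE (Q k) x) = ∞)
    (hσ : sqNorm σ p (fun k x => b k * indE (Q k) x) ≠ ∞) :
    sqA D σ w p q = ∞ := by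
  refine eq_top_iff.2 (le_sInf fun C hC => ?_)
  set a : Set (EucN N) → ℝ := Function.extend Q (fun k => (b k).toReal) 0 with ha
  have ha0 : ∀ S ∉ range Q, a S = 0 := fun S hS =>
    Function.extend_apply' _ _ _ hS
  have hab : ∀ k, (‖a (Q k)‖₊ : ℝ≥0∞) = b k := fun k => by
    rw [ha, hinj.extend_apply, ← ENNReal.ofReal_toReal (hb k), ENNReal.toReal_ofReal (by simp)]
    exact Real.enorm_of_nonneg (by simp)
  have h := hC a
  rw [sqNorm_cubes_eq_sqNorm_nat D w q hQ hinj
      (b := fun S => (‖a S‖₊ : ℝ≥0∞) * σ S / volume S) (fun S hS => by simp [ha0 S hS]),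
    sqNorm_cubes_eq_sqNorm_nat D σ p hQ hinj
      (b := fun S => (‖a S‖₊ : ℝ≥0∞)) (fun S hS => by simp [ha0 S hS])] at h
  simp only [hab] at h
  rw [hw, top_le_iff, ENNReal.mul_eq_top] at h
  rcases h with h | h
  · exact absurd h.2 hσ
  · exact h.1.ge

theorem tsum_add_one_rpow_ne_top_iff (r : ℝ) :
    ∑' k : ℕ, ((k : ℝ≥0∞) + 1) ^ r ≠ ∞ ↔ r < -1 := by
  have h : ∀ k : ℕ, ((k : ℝ≥0∞) + 1) ^ r = (((((k + 1 : ℕ) : NNReal)) ^ r : NNReal) : ℝ≥0∞) :=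
    fun k => by
      rw [ENNReal.coe_rpow_of_ne_zero (by positivity)]
      push_cast
      rfl
  simp only [h]
  rw [ENNReal.tsum_coe_ne_top_iff_summable,
    NNReal.summable_nat_add_iff (f := fun k : ℕ => (k : NNReal) ^ r) 1]
  exact NNReal.summable_rpow

theorem tsum_add_one_mul_pow_ne_top {u : ℝ≥0∞} (hu : u < 1) :
    ∑' k : ℕ, ((k : ℝ≥0∞) + 1) * u ^ k ≠ ∞ := by
  lift u to NNReal using hu.ne_top
  have h : ∀ k : ℕ, ((k : ℝ≥0∞) + 1) * (u : ℝ≥0∞) ^ k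
      = (((k : NNReal) + 1) * u ^ k : NNReal) := fun k => by push_cast; rfl
  simp only [h]
  rw [ENNReal.tsum_coe_ne_top_iff_summable, ← NNReal.summable_coe]
  have hu' : ‖(u : ℝ)‖ < 1 := by
    simpa using hu
  have h1 := summable_pow_mul_geometric_of_norm_lt_one 1 hu'
  have h2 := summable_geometric_of_norm_lt_one hu'
  refine (h1.add h2).congr fun k => ?_
  push_cast
  ring

/-- Sums of `u⁻ʲ / (j + 1)` are dominated by their last term. -/
theorem sum_inv_pow_mul_inv_le {u : ℝ≥0∞} (hu0 : u ≠ 0) (hu : u < 1) (k : ℕ) :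
    ∑ j ∈ Finset.range (k + 1), (u ^ j)⁻¹ * ((j : ℝ≥0∞) + 1)⁻¹
      ≤ (∑' i : ℕ, ((i : ℝ≥0∞) + 1) * u ^ i) * ((u ^ k)⁻¹ * ((k : ℝ≥0∞) + 1)⁻¹) := by
  have hterm : ∀ j ∈ Finset.range (k + 1), (u ^ j)⁻¹ * ((j : ℝ≥0∞) + 1)⁻¹
      ≤ (((k - j : ℕ) : ℝ≥0∞) + 1) * u ^ (k - j) * ((u ^ k)⁻¹ * ((k : ℝ≥0∞) + 1)⁻¹) := by
    intro j hj
    obtain ⟨i, rfl⟩ := Nat.exists_eq_add_of_le (Nat.lt_succ_iff.1 (Finset.mem_range.1 hj))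
    rw [Nat.add_sub_cancel_left]
    have hui : u ^ i ≠ 0 := pow_ne_zero _ hu0
    have hui' : u ^ i ≠ ∞ := ENNReal.pow_ne_top hu.ne_top
    have h1 : (u ^ j)⁻¹ = u ^ i * (u ^ (j + i))⁻¹ := by
      rw [pow_add, ENNReal.mul_inv (Or.inl (pow_ne_zero _ hu0))
        (Or.inl (ENNReal.pow_ne_top hu.ne_top)), mul_left_comm, ENNReal.mul_inv_cancel hui hui',
        mul_one]
    have h2 : ((j : ℝ≥0∞) + 1)⁻¹ ≤ ((i : ℝ≥0∞) + 1) * (((j + i : ℕ) : ℝ≥0∞) + 1)⁻¹ := by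
      rw [← div_eq_mul_inv, ENNReal.le_div_iff_mul_le (by simp) (by simp), mul_comm,
        ← div_eq_mul_inv]
      refine ENNReal.div_le_of_le_mul ?_
      norm_cast
      nlinarith [Nat.zero_le (i * j)]
    rw [h1]
    calc _ ≤ u ^ i * (u ^ (j + i))⁻¹ * (((i : ℝ≥0∞) + 1) * (((j + i : ℕ) : ℝ≥0∞) + 1)⁻¹) := by
          gcongr
      _ = _ := by ring
  refine (Finset.sum_le_sum hterm).trans ?_
  rw [← Finset.sum_mul, Finset.sum_flip fun i => ((i : ℝ≥0∞) + 1) * u ^ i]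
  gcongr
  exact ENNReal.sum_le_tsum _

theorem rpow_div_le_of_le_mul_rpow {m K v : ℝ≥0∞} {s e : ℝ} (he : 0 ≤ e) (hse : s * e = 1)
    (h : m ≤ K * v ^ s) : m ^ e / v ≤ K ^ e := by
  refine ENNReal.div_le_of_le_mul ((ENNReal.rpow_le_rpow h he).trans_eq ?_)
  rw [ENNReal.mul_rpow_of_nonneg _ _ he, ← ENNReal.rpow_mul, hse, ENNReal.rpow_one]

theorem rpow_pow_comm (T : ℝ≥0∞) (s : ℝ) (k : ℕ) : (T ^ s) ^ k = (T ^ k) ^ s := by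
  rw [← ENNReal.rpow_natCast, ← ENNReal.rpow_natCast, ← ENNReal.rpow_mul, ← ENNReal.rpow_mul,
    mul_comm]

theorem rpow_sq (A : ℝ≥0∞) (s : ℝ) : (A ^ s) ^ 2 = A ^ (2 * s) := by
  rw [← ENNReal.rpow_natCast, ← ENNReal.rpow_mul, mul_comm]
  norm_num

theorem sq_rpow_half (A : ℝ≥0∞) (s : ℝ) : (A ^ 2) ^ (s / 2) = A ^ s := by
  rw [← ENNReal.rpow_natCast, ← ENNReal.rpow_mul]
  congr 1; push_cast; ring

namespace DyadicLattice
variable {N : ℕ} (D : DyadicLattice N)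

/-- A sequence of cubes shrinking to the origin, and for every `s > 0` a finite measure whose mass
on the cubes containing the origin is comparable to the `s`-th power of the volume. -/
theorem exists_tower_measure (hN : 1 ≤ N) {s : ℝ} (hs : 0 < s) :
    ∃ (Q : ℕ → Set (EucN N)) (x : ℕ → EucN N) (T : ℝ≥0∞), T ≠ 0 ∧ T < 1 ∧
      (∀ k, Q k ∈ D.cubes) ∧ Function.Injective Q ∧ (∀ k, 0 ∈ Q k) ∧
      (∀ j k, x k ∈ Q j ↔ j ≤ k) ∧ (∀ k, volume (Q k) = T ^ k) ∧
      IsFiniteMeasure (geomMeasure x (T ^ s)) ∧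
      (∀ k, (T ^ k) ^ s ≤ geomMeasure x (T ^ s) (Q k)) ∧
      ∃ K ≠ ∞, ∀ S ∈ D.cubes, 0 ∈ S → geomMeasure x (T ^ s) S ≤ K * volume S ^ s := by
  obtain ⟨Q, x, hQ, h0, hx, htower⟩ := D.exists_tower hN
  set T : ℝ≥0∞ := 2⁻¹ ^ N with hT
  have hvol : ∀ k, volume (Q k) = T ^ k := fun k => D.volume_of_mem_gen (hQ k)
  have hT1 : T < 1 := pow_lt_one₀ (by simp) (by simp) (by omega)
  have hR : T ^ s < 1 := ENNReal.rpow_lt_one hT1 hs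
  have hQc : ∀ k, Q k ∈ D.cubes := fun k => mem_iUnion.2 ⟨k, hQ k⟩
  have hmeas : ∀ k, geomMeasure x (T ^ s) (Q k) = (T ^ k) ^ s * (1 - T ^ s)⁻¹ := fun k => by
    rw [geomMeasure_tower hx (D.measurableSet_of_mem_cubes (hQc k)), rpow_pow_comm]
  refine ⟨Q, x, T, by simp [hT], hT1, hQc, fun i j hij => ?_, h0, hx, hvol,
    isFiniteMeasure_geomMeasure hR, fun k => ?_, (1 - T ^ s)⁻¹,
    ENNReal.inv_ne_top.2 (tsub_pos_of_lt hR).ne',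
    fun S hS hS0 => ?_⟩
  · exact le_antisymm ((hx i j).1 (hij ▸ (hx j j).2 le_rfl)) ((hx j i).1 (hij ▸ (hx i i).2 le_rfl))
  · rw [hmeas]
    exact le_mul_of_one_le_right (by simp) (ENNReal.one_le_inv.2 tsub_le_self)
  · rcases htower S hS hS0 with ⟨k, rfl⟩ | h1
    · rw [hmeas, hvol, mul_comm]
    · calc geomMeasure x (T ^ s) S ≤ (1 - T ^ s)⁻¹ := by
            rw [← geomMeasure_univ (x := x)]; exact measure_mono (subset_univ S)
        _ ≤ _ := le_mul_of_one_le_right (by simp) (ENNReal.one_le_rpow h1 hs)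

theorem exists_simpleA_ne_top_sqA_eq_top_of_lt_two (hN : 1 ≤ N) {p q : ℝ} (hp : 1 < p)
    (hq : 1 < q) (hq2 : q < 2) : ∃ σ w : Measure (EucN N),
      IsFiniteMeasure σ ∧ IsFiniteMeasure w ∧
        simpleA D σ w p q ≠ ∞ ∧ sqA D σ w p q = ∞ := by
  have hq0 : 0 < q := by linarith
  have hp' : 0 < 1 - 1 / p := by rw [sub_pos, div_lt_one] <;> linarith
  obtain ⟨Q, x, T, hT0, hT1, hQ, hinj, h0, hx, hvol, hfin, -, K, hK, hle⟩ :=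
    D.exists_tower_measure hN hq0
  refine ⟨Measure.dirac 0, geomMeasure x (T ^ q), inferInstance, hfin, ?_, ?_⟩
  · refine ne_top_of_le_ne_top (ENNReal.rpow_ne_top_of_nonneg (y := 1 / q) (by positivity) hK)
      (iSup₂_le fun S hS => ?_)
    by_cases hS0 : (0 : EucN N) ∈ S
    · rw [Measure.dirac_apply, indicator_of_mem hS0, Pi.one_apply, ENNReal.one_rpow, one_mul]
      exact rpow_div_le_of_le_mul_rpow (by positivity) (mul_one_div_cancel hq0.ne') (hle S hS hS0)
    · rw [Measure.dirac_apply, indicator_of_notMem hS0, ENNReal.zero_rpow_of_pos hp', zero_mul,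
        ENNReal.zero_div]
      simp
  · have hm0 : ∀ k : ℕ, (k : ℝ≥0∞) + 1 ≠ 0 := fun k => by simp
    have hm1 : ∀ k : ℕ, (k : ℝ≥0∞) + 1 ≠ ∞ := fun k => by simp
    refine sqA_eq_top D hQ hinj (b := fun k => ((k : ℝ≥0∞) + 1) ^ (-(1 / q)))
      (fun k => ENNReal.rpow_ne_top_of_ne_zero (hm0 k) (hm1 k)) ?_ ?_
    · rw [sqNorm_geomMeasure hx, ENNReal.rpow_eq_top_iff_of_pos (by positivity)]
      have hdiv : ∑' k : ℕ, ((k : ℝ≥0∞) + 1) ^ (-1 : ℝ) = ∞ := by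
        by_contra h
        exact lt_irrefl _ ((tsum_add_one_rpow_ne_top_iff (-1)).1 h)
      refine eq_top_iff.2 (hdiv.ge.trans (ENNReal.tsum_le_tsum fun k => ?_))
      have hTk : T ^ k ≠ 0 := pow_ne_zero _ hT0
      have hTk' : T ^ k ≠ ∞ := ENNReal.pow_ne_top hT1.ne_top
      have hterm : ((k : ℝ≥0∞) + 1) ^ (-1 : ℝ) = (T ^ q) ^ k
          * ((((k : ℝ≥0∞) + 1) ^ (-(1 / q)) * Measure.dirac 0 (Q k) / volume (Q k)) ^ 2)
            ^ (q / 2) := by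
        rw [Measure.dirac_apply, indicator_of_mem (h0 k), Pi.one_apply, mul_one, hvol,
          rpow_pow_comm, sq_rpow_half, ← ENNReal.mul_rpow_of_nonneg _ _ hq0.le,
          ENNReal.mul_div_cancel hTk hTk',
          ← ENNReal.rpow_mul]
        congr 1; field_simp
      rw [hterm]
      gcongr
      exact Finset.single_le_sum (f := fun j : ℕ => (((j : ℝ≥0∞) + 1) ^ (-(1 / q))
        * Measure.dirac 0 (Q j) / volume (Q j)) ^ 2) (fun _ _ => by simp) (by simp)
    · rw [sqNorm_dirac h0]
      refine ENNReal.rpow_ne_top_of_nonneg (by positivity)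
        (ENNReal.rpow_ne_top_of_nonneg (by positivity) ?_)
      have h : ∀ k : ℕ, (((k : ℝ≥0∞) + 1) ^ (-(1 / q))) ^ 2
          = ((k : ℝ≥0∞) + 1) ^ (-(2 / q)) := fun k => by
        rw [rpow_sq]
        congr 1; ring
      simp only [h]
      rw [tsum_add_one_rpow_ne_top_iff, neg_lt_neg_iff, one_lt_div hq0]
      exact hq2

theorem exists_simpleA_ne_top_sqA_eq_top_of_two_lt (hN : 1 ≤ N) {p q : ℝ} (hp2 : 2 < p)
    (hq : 1 < q) : ∃ σ w : Measure (EucN N),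
      IsFiniteMeasure σ ∧ IsFiniteMeasure w ∧
        simpleA D σ w p q ≠ ∞ ∧ sqA D σ w p q = ∞ := by
  have hq0 : 0 < q := by linarith
  have hp0 : 0 < p := by linarith
  have hp1 : 0 < p - 1 := by linarith
  have hp' : 0 < 1 - 1 / p := by rw [sub_pos, div_lt_one] <;> linarith
  obtain ⟨s, hs⟩ : ∃ s, s = p / (p - 1) := ⟨_, rfl⟩
  have hs0 : 0 < s := by rw [hs]; positivity
  have hs1 : 0 < s - 1 := by rw [hs, sub_pos, one_lt_div hp1]; linarith
  have hsp : (s - 1) * p = s := by rw [hs]; field_simp; ring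
  obtain ⟨Q, x, T, hT0, hT1, hQ, hinj, h0, hx, hvol, hfin, hge, K, hK, hle⟩ :=
    D.exists_tower_measure hN hs0
  refine ⟨geomMeasure x (T ^ s), Measure.dirac 0, hfin, inferInstance, ?_, ?_⟩
  · refine ne_top_of_le_ne_top (ENNReal.rpow_ne_top_of_nonneg (y := 1 - 1 / p) hp'.le hK)
      (iSup₂_le fun S hS => ?_)
    by_cases hS0 : (0 : EucN N) ∈ S
    · rw [Measure.dirac_apply, indicator_of_mem hS0, Pi.one_apply, ENNReal.one_rpow, mul_one]
      refine rpow_div_le_of_le_mul_rpow hp'.le ?_ (hle S hS hS0)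
      rw [hs]; field_simp
    · rw [Measure.dirac_apply, indicator_of_notMem hS0, ENNReal.zero_rpow_of_pos (by positivity),
        mul_zero, ENNReal.zero_div]
      simp
  · have hm0 : ∀ k : ℕ, (k : ℝ≥0∞) + 1 ≠ 0 := fun k => by simp
    have hm1 : ∀ k : ℕ, (k : ℝ≥0∞) + 1 ≠ ∞ := fun k => by simp
    have hTk : ∀ k, T ^ k ≠ 0 := fun k => pow_ne_zero _ hT0
    have hTk' : ∀ k, T ^ k ≠ ∞ := fun k => ENNReal.pow_ne_top hT1.ne_top
    refine sqA_eq_top D hQ hinj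
      (b := fun k => (T ^ k) ^ (1 - s) * ((k : ℝ≥0∞) + 1) ^ (-(1 / 2) : ℝ))
      (fun k => ENNReal.mul_ne_top (ENNReal.rpow_ne_top_of_ne_zero (hTk k) (hTk' k))
        (ENNReal.rpow_ne_top_of_ne_zero (hm0 k) (hm1 k))) ?_ ?_
    · rw [sqNorm_dirac h0, ENNReal.rpow_eq_top_iff_of_pos (by positivity),
        ENNReal.rpow_eq_top_iff_of_pos (by positivity)]
      have hdiv : ∑' k : ℕ, ((k : ℝ≥0∞) + 1) ^ (-1 : ℝ) = ∞ := by
        by_contra h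
        exact lt_irrefl _ ((tsum_add_one_rpow_ne_top_iff (-1)).1 h)
      refine eq_top_iff.2 (hdiv.ge.trans (ENNReal.tsum_le_tsum fun k => ?_))
      have hterm : ((k : ℝ≥0∞) + 1) ^ (-1 : ℝ)
          = ((T ^ k) ^ (1 - s) * ((k : ℝ≥0∞) + 1) ^ (-(1 / 2) : ℝ) * (T ^ k) ^ s / T ^ k) ^ 2 := by
        rw [mul_right_comm, ← ENNReal.rpow_add _ _ (hTk k) (hTk' k), sub_add_cancel,
          ENNReal.rpow_one, ENNReal.mul_div_right_comm, ENNReal.div_self (hTk k) (hTk' k), one_mul,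
          rpow_sq]
        norm_num
      rw [hterm, hvol]
      gcongr
      exact hge k
    · rw [sqNorm_geomMeasure hx]
      refine ENNReal.rpow_ne_top_of_nonneg (by positivity) ?_
      obtain ⟨u, hu⟩ : ∃ u, u = T ^ (2 * (s - 1)) := ⟨_, rfl⟩
      have hu0 : u ≠ 0 := by
        rw [hu]; exact (ENNReal.rpow_pos (pos_iff_ne_zero.2 hT0) hT1.ne_top).ne'
      have hu1 : u < 1 := by rw [hu]; exact ENNReal.rpow_lt_one hT1 (by positivity)
      have hsq : ∀ j : ℕ, ((T ^ j) ^ (1 - s) * ((j : ℝ≥0∞) + 1) ^ (-(1 / 2) : ℝ)) ^ 2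
          = (u ^ j)⁻¹ * ((j : ℝ≥0∞) + 1)⁻¹ := fun j => by
        rw [hu, rpow_pow_comm, ← ENNReal.rpow_neg, mul_pow, rpow_sq, rpow_sq,
          ← ENNReal.rpow_neg_one]
        congr 2 <;> ring
      simp only [hsq]
      set C := ∑' i : ℕ, ((i : ℝ≥0∞) + 1) * u ^ i
      have hC1 : C ≠ ∞ := tsum_add_one_mul_pow_ne_top hu1
      have hbound : ∀ k : ℕ, (T ^ s) ^ k * (∑ j ∈ Finset.range (k + 1),
          (u ^ j)⁻¹ * ((j : ℝ≥0∞) + 1)⁻¹) ^ (p / 2)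
          ≤ C ^ (p / 2) * ((k : ℝ≥0∞) + 1) ^ (-(p / 2)) := fun k => by
        calc _ ≤ (T ^ s) ^ k * (C * ((u ^ k)⁻¹ * ((k : ℝ≥0∞) + 1)⁻¹)) ^ (p / 2) := by
              gcongr
              exact sum_inv_pow_mul_inv_le hu0 hu1 k
          _ = ((T ^ k) ^ s * ((u ^ k)⁻¹) ^ (p / 2))
              * (C ^ (p / 2) * ((k : ℝ≥0∞) + 1) ^ (-(p / 2))) := by
            rw [ENNReal.mul_rpow_of_nonneg _ _ (by positivity),
              ENNReal.mul_rpow_of_nonneg _ _ (by positivity), rpow_pow_comm, ENNReal.rpow_neg,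
              ← ENNReal.inv_rpow ((k : ℝ≥0∞) + 1)]
            ring
          _ = _ := by
            rw [hu, rpow_pow_comm, ← ENNReal.rpow_neg, ← ENNReal.rpow_mul,
              ← ENNReal.rpow_add _ _ (hTk k) (hTk' k)]
            have : s + -(2 * (s - 1)) * (p / 2) = 0 := by linear_combination -hsp
            rw [this, ENNReal.rpow_zero, one_mul]
      refine ne_top_of_le_ne_top ?_ (ENNReal.tsum_le_tsum hbound)
      rw [ENNReal.tsum_mul_left]
      refine ENNReal.mul_ne_top (ENNReal.rpow_ne_top_of_nonneg (by positivity) hC1) ?_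
      rw [tsum_add_one_rpow_ne_top_iff]
      linarith

end DyadicLattice

/-- (a) If `1 < p ≤ 2 ≤ q < ∞`, then `(σ,w)_{p,q} = [σ,w]_{p,q}` for all
Radon measures `σ`, `w` on `ℝ^N`. (b) If `2 < p < ∞` or `1 < q < 2`, then there exist Radon
measures `σ` and `w` such that `(σ,w)_{p,q} < ∞` but `[σ,w]_{p,q} = ∞`. -/
theorem simple_vs_quadratic_Apq (N : ℕ) (hN : 1 ≤ N) (p q : ℝ) (hp : 1 < p) (hq : 1 < q) :
    ((p ≤ 2 ∧ 2 ≤ q) →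
      ∀ (D : DyadicLattice N) (σ w : Measure (EucN N)),
        IsLocallyFiniteMeasure σ → IsLocallyFiniteMeasure w →
        simpleA D σ w p q = sqA D σ w p q) ∧
    ((2 < p ∨ q < 2) →
      ∀ D : DyadicLattice N, ∃ σ w : Measure (EucN N),
        IsLocallyFiniteMeasure σ ∧ IsLocallyFiniteMeasure w ∧
        simpleA D σ w p q ≠ ∞ ∧ sqA D σ w p q = ∞) := by
  refine ⟨fun ⟨hp2, hq2⟩ D σ w _ _ => le_antisymm (simpleA_le_sqA D σ w hp hq)
    (sqA_le_simpleA D σ w hp hp2 hq2), fun h D => ?_⟩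
  obtain ⟨σ, w, _, _, h1, h2⟩ : ∃ σ w : Measure (EucN N), IsFiniteMeasure σ ∧ IsFiniteMeasure w ∧
      simpleA D σ w p q ≠ ∞ ∧ sqA D σ w p q = ∞ :=
    h.elim (fun hp2 => D.exists_simpleA_ne_top_sqA_eq_top_of_two_lt hN hp2 hq)
      (fun hq2 => D.exists_simpleA_ne_top_sqA_eq_top_of_lt_two hN hp hq hq2)
  exact ⟨σ, w, inferInstance, inferInstance, h1, h2⟩

end
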